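/- Let L>0, ε₀>0, M>0, T₀>0, K₁>0, ρ∈(0,L), a,b∈ℝ, and let m:[0,L]→ℝ be twice continuously differentiable with m(x)>0 for all x. For ε∈(0,ε₀) set μ_ε(x)=m(x)/ε², and define T(x)=(1/4)[−(5/9)m(x)/(∫₀ˣ√(m(t))dt)² + m''(x)/m(x) − (5/4)(m'(x))²/m(x)²] (T does not depend on ε; here the first ratio uses ξ̄(x)=∫₀ˣ√(m(t))dt, and −m/ξ̄² is replaced consistently by the paper's convention m/ξ̄² with the appropriate sign so that T is the same function for ±m). Suppose that for each ε∈(0,ε₀) there are functions ū_ε,v̄_ε, continuous on [0,L] and twice continuously differentiable on (0,L), with ū_ε''=(−μ_ε−T)ū_ε and v̄_ε''=(−μ_ε−T)v̄_ε on (0,L), satisfying the ε-uniform bounds |ū_ε(x)|≤M/μ_ε(x)^{1/4} and |v̄_ε(x)|≤M/μ_ε(x)^{1/4}. Suppose moreover |T(s)|≤T₀ for s∈[ρ,L], and the near-origin bound sup_{x∈[0,ρ]} ∫ₓ^ρ |T(s)|·|ū_ε(x)v̄_ε(s)−v̄_ε(x)ū_ε(s)| ds ≤ K₁·ε. If for each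 ε∈(0,ε₀), y_ε:[0,L]→ℝ is continuous and satisfies y_ε(x)=a·ū_ε(x)+b·v̄_ε(x)+∫ₓ^L (ū_ε(x)v̄_ε(s)−v̄_ε(x)ū_ε(s))·T(s)·y_ε(s) ds for all x∈[0,L], then lim_{ε→0⁺} sup_{x∈[0,L]} |y_ε(x)−a·ū_ε(x)−b·v̄_ε(x)| = 0. -/

import Mathlib

open Set Filter Topology

/-- If `m` is bounded below by a positive constant on a compact interval, then the amplitude
`(m / ε²)^{-1/4}` is `O(√ε)` uniformly in `x`. -/
lemma exists_amplitude_le {L M : ℝ} (hL : 0 < L) (hM : 0 < M) {m : ℝ → ℝ}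
    (hmc : ContinuousOn m (Icc 0 L)) (hmpos : ∀ x ∈ Icc (0 : ℝ) L, 0 < m x) :
    ∃ B : ℝ, 0 < B ∧ ∀ ε : ℝ, 0 < ε → ∀ x ∈ Icc (0 : ℝ) L,
      M / (m x / ε ^ 2) ^ ((1 : ℝ) / 4) ≤ B * √ε := by
  obtain ⟨z, hz, hmin⟩ := isCompact_Icc.exists_isMinOn (nonempty_Icc.2 hL.le) hmc
  have hmz := hmpos z hz
  refine ⟨M / (m z) ^ ((1 : ℝ) / 4), by positivity, fun ε hε x hx => ?_⟩
  have hle : m z ≤ m x := hmin hx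
  have hpow : (ε ^ 2) ^ ((1 : ℝ) / 4) = √ε := by
    rw [Real.sqrt_eq_rpow, ← Real.rpow_natCast, ← Real.rpow_mul hε.le]
    norm_num
  rw [Real.div_rpow (hmpos x hx).le (by positivity), hpow, div_div_eq_mul_div, mul_div_right_comm]
  gcongr

/-- The potential `T` is continuous away from the turning point `0`. -/
lemma continuousOn_potential {L : ℝ} (hL : 0 ≤ L) {m m' m'' T : ℝ → ℝ}
    (hmc : ContinuousOn m (Icc 0 L)) (hm'c : ContinuousOn m' (Icc 0 L))
    (hm''c : ContinuousOn m'' (Icc 0 L)) (hmpos : ∀ x ∈ Icc (0 : ℝ) L, 0 < m x)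
    (hT : ∀ x, T x = (1/4) * ((5/9) * m x / (∫ t in (0:ℝ)..x, Real.sqrt (m t)) ^ 2
        + m'' x / m x - (5/4) * (m' x) ^ 2 / (m x) ^ 2)) :
    ContinuousOn T (Ioc 0 L) := by
  have hsub : Ioc (0 : ℝ) L ⊆ Icc 0 L := Ioc_subset_Icc_self
  have hs : ContinuousOn (fun t => √(m t)) (Icc 0 L) := hmc.sqrt
  have hprim : ContinuousOn (fun x => ∫ t in (0:ℝ)..x, √(m t)) (Ioc 0 L) :=
    (intervalIntegral.continuousOn_primitive_interval' (b₁ := 0) (b₂ := L)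
      (hs.intervalIntegrable_of_Icc hL) left_mem_uIcc).mono (by rwa [uIcc_of_le hL])
  have hpos : ∀ x ∈ Ioc (0 : ℝ) L, (∫ t in (0:ℝ)..x, √(m t)) ^ 2 ≠ 0 := fun x hx => by
    have hx' : Icc 0 x ⊆ Icc 0 L := Icc_subset_Icc_right hx.2
    refine pow_ne_zero 2 (intervalIntegral.intervalIntegral_pos_of_pos_on
      ((hs.mono hx').intervalIntegrable_of_Icc hx.1.le) (fun t ht => ?_) hx.1).ne'
    exact Real.sqrt_pos.2 (hmpos t (hx' (Ioo_subset_Icc_self ht)))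
  have hm0 : ∀ x ∈ Ioc (0 : ℝ) L, m x ≠ 0 := fun x hx => (hmpos x (hsub hx)).ne'
  have h1 := hmc.mono hsub
  have h2 := hm'c.mono hsub
  have h3 := hm''c.mono hsub
  rw [funext hT]
  exact continuousOn_const.mul ((((continuousOn_const.mul h1).div (hprim.pow 2) hpos).add
    (h3.div h1 hm0)).sub ((continuousOn_const.mul (h2.pow 2)).div (h1.pow 2)
      fun x hx => pow_ne_zero 2 (hm0 x hx)))

/-- The Volterra kernel of two modes bounded by `δ` is bounded by `2 δ²`. -/
lemma abs_mul_sub_mul_le {p q r s δ : ℝ} (hp : |p| ≤ δ) (hq : |q| ≤ δ) (hr : |r| ≤ δ)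
    (hs : |s| ≤ δ) : |p * q - r * s| ≤ 2 * δ ^ 2 := by
  have h0 : 0 ≤ δ := (abs_nonneg p).trans hp
  calc |p * q - r * s| ≤ |p * q| + |r * s| := abs_sub _ _
    _ = |p| * |q| + |r| * |s| := by rw [abs_mul, abs_mul]
    _ ≤ δ * δ + δ * δ := by gcongr
    _ = 2 * δ ^ 2 := by ring

/-- A bound on `(0, L]` for the Volterra operator with kernel `u x * v s - v x * u s` and
potential `T`, split at `ρ` into a part near the singularity of `T` and a regular part. -/
lemma abs_volterra_integral_le {L ρ T0 δ N Y x : ℝ} (hρ : ρ ∈ Ioo (0 : ℝ) L)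
    (hN : 0 ≤ N) {T u v y : ℝ → ℝ}
    (hTc : ContinuousOn T (Ioc 0 L)) (hT0 : 0 ≤ T0) (hTb : ∀ s ∈ Icc ρ L, |T s| ≤ T0)
    (huc : ContinuousOn u (Icc 0 L)) (hvc : ContinuousOn v (Icc 0 L))
    (hub : ∀ s ∈ Icc (0 : ℝ) L, |u s| ≤ δ) (hvb : ∀ s ∈ Icc (0 : ℝ) L, |v s| ≤ δ)
    (hnear : ∀ x ∈ Icc (0 : ℝ) ρ, (∫ s in x..ρ, |T s| * |u x * v s - v x * u s|) ≤ N)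
    (hy : ∀ s ∈ Icc (0 : ℝ) L, |y s| ≤ Y) (hx : x ∈ Ioc 0 L) :
    |∫ s in x..L, (u x * v s - v x * u s) * T s * y s|
      ≤ (N + 2 * δ ^ 2 * T0 * L) * Y := by
  set g : ℝ → ℝ := fun s => |T s| * |u x * v s - v x * u s| with hg
  have hsub : Ioc (0 : ℝ) L ⊆ Icc 0 L := Ioc_subset_Icc_self
  have hgc : ContinuousOn g (Ioc 0 L) :=
    hTc.abs.mul ((continuousOn_const.mul (hvc.mono hsub)).sub
      (continuousOn_const.mul (huc.mono hsub))).abs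
  have hgi : ∀ c ∈ Ioc (0 : ℝ) L, ∀ d ∈ Ioc (0 : ℝ) L,
      IntervalIntegrable g MeasureTheory.volume c d := fun c hc d hd =>
    (hgc.mono (ordConnected_Ioc.uIcc_subset hc hd)).intervalIntegrable
  have hL : L ∈ Ioc (0 : ℝ) L := ⟨hρ.1.trans hρ.2, le_rfl⟩
  have hρ' : ρ ∈ Ioc (0 : ℝ) L := ⟨hρ.1, hρ.2.le⟩
  have hY : 0 ≤ Y := (abs_nonneg _).trans (hy x (hsub hx))
  have hfar : ∀ c ∈ Icc ρ L, (∫ s in c..L, g s) ≤ 2 * δ ^ 2 * T0 * L := fun c hc => by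
    have h := intervalIntegral.norm_integral_le_of_norm_le_const
      (f := g) (a := c) (b := L) (C := 2 * δ ^ 2 * T0) (fun s hs => by
        rw [uIoc_of_le hc.2] at hs
        have hsρ : s ∈ Icc ρ L := ⟨hc.1.trans hs.1.le, hs.2⟩
        have hs0 : s ∈ Icc (0 : ℝ) L := ⟨hρ.1.le.trans hsρ.1, hs.2⟩
        change ‖|T s| * |u x * v s - v x * u s|‖ ≤ _
        rw [Real.norm_of_nonneg (by positivity), mul_comm |T s|]
        exact mul_le_mul (abs_mul_sub_mul_le (hub x (hsub hx)) (hvb s hs0)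
          (hvb x (hsub hx)) (hub s hs0)) (hTb s hsρ) (abs_nonneg _) (by positivity))
    refine (le_abs_self _).trans (h.trans ?_)
    have hc0 : 0 < c := hρ.1.trans_le hc.1
    rw [abs_of_nonneg (sub_nonneg.2 hc.2)]
    gcongr
    linarith
  have hgL : (∫ s in x..L, g s) ≤ N + 2 * δ ^ 2 * T0 * L := by
    rcases le_total x ρ with h | h
    · rw [← intervalIntegral.integral_add_adjacent_intervals (hgi x hx ρ hρ') (hgi ρ hρ' L hL)]
      exact add_le_add (hnear x ⟨hx.1.le, h⟩) (hfar ρ ⟨le_rfl, hρ.2.le⟩)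
    · exact (hfar x ⟨h, hx.2⟩).trans (le_add_of_nonneg_left hN)
  calc |∫ s in x..L, (u x * v s - v x * u s) * T s * y s|
      ≤ ∫ s in x..L, g s * Y := by
        rw [← Real.norm_eq_abs]
        refine intervalIntegral.norm_integral_le_of_norm_le hx.2
          (Eventually.of_forall fun s hs => ?_) ((hgi x hx L hL).mul_const Y)
        rw [Real.norm_eq_abs, abs_mul, abs_mul, mul_comm |_| |T s|]
        exact mul_le_mul_of_nonneg_left (hy s ⟨hx.1.le.trans hs.1.le, hs.2⟩) (by positivity)
    _ = (∫ s in x..L, g s) * Y := intervalIntegral.integral_mul_const _ _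
    _ ≤ _ := mul_le_mul_of_nonneg_right hgL hY

/-- Theorem 2.2 of the paper (oscillatory case), with the properties of the
Bessel-built solutions `ū_ε`, `v̄_ε` of `ψ'' = (-μ_ε - T)ψ`, `μ_ε = m/ε²`, `m > 0`, made
explicit hypotheses: both modes are bounded by `M μ_ε^{-1/4}` and the residual
`sup_{[0,L]} |y_ε - a ū_ε - b v̄_ε|` of the implicit solution tends to `0` as `ε → 0⁺`. -/
theorem stmt11 (L ε0 M T0 K1 ρ a b : ℝ)
    (hL : 0 < L) (hε0 : 0 < ε0) (hM : 0 < M) (hT0 : 0 < T0) (hK1 : 0 < K1)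
    (hρ : ρ ∈ Ioo (0:ℝ) L)
    (m m' m'' : ℝ → ℝ)
    (hm : ∀ x ∈ Icc (0:ℝ) L, HasDerivAt m (m' x) x)
    (hm' : ∀ x ∈ Icc (0:ℝ) L, HasDerivAt m' (m'' x) x)
    (hm''c : ContinuousOn m'' (Icc 0 L))
    (hmpos : ∀ x ∈ Icc (0:ℝ) L, 0 < m x)
    (T : ℝ → ℝ)
    (hT : ∀ x, T x = (1/4) * ((5/9) * m x / (∫ t in (0:ℝ)..x, Real.sqrt (m t)) ^ 2
        + m'' x / m x - (5/4) * (m' x) ^ 2 / (m x) ^ 2))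
    (u u' v v' : ℝ → ℝ → ℝ)
    (huc : ∀ ε ∈ Ioo (0:ℝ) ε0, ContinuousOn (u ε) (Icc 0 L))
    (hvc : ∀ ε ∈ Ioo (0:ℝ) ε0, ContinuousOn (v ε) (Icc 0 L))
    (hu : ∀ ε ∈ Ioo (0:ℝ) ε0, ∀ x ∈ Ioo (0:ℝ) L, HasDerivAt (u ε) (u' ε x) x)
    (hu' : ∀ ε ∈ Ioo (0:ℝ) ε0, ∀ x ∈ Ioo (0:ℝ) L,
      HasDerivAt (u' ε) ((-(m x / ε ^ 2) - T x) * u ε x) x)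
    (hv : ∀ ε ∈ Ioo (0:ℝ) ε0, ∀ x ∈ Ioo (0:ℝ) L, HasDerivAt (v ε) (v' ε x) x)
    (hv' : ∀ ε ∈ Ioo (0:ℝ) ε0, ∀ x ∈ Ioo (0:ℝ) L,
      HasDerivAt (v' ε) ((-(m x / ε ^ 2) - T x) * v ε x) x)
    (hub : ∀ ε ∈ Ioo (0:ℝ) ε0, ∀ x ∈ Icc (0:ℝ) L,
      |u ε x| ≤ M / (m x / ε ^ 2) ^ ((1:ℝ)/4))
    (hvb : ∀ ε ∈ Ioo (0:ℝ) ε0, ∀ x ∈ Icc (0:ℝ) L,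
      |v ε x| ≤ M / (m x / ε ^ 2) ^ ((1:ℝ)/4))
    (hTb : ∀ s ∈ Icc ρ L, |T s| ≤ T0)
    (hnear : ∀ ε ∈ Ioo (0:ℝ) ε0, ∀ x ∈ Icc (0:ℝ) ρ,
      (∫ s in x..ρ, |T s| * |u ε x * v ε s - v ε x * u ε s|) ≤ K1 * ε)
    (y : ℝ → ℝ → ℝ)
    (hyc : ∀ ε ∈ Ioo (0:ℝ) ε0, ContinuousOn (y ε) (Icc 0 L))
    (hyeq : ∀ ε ∈ Ioo (0:ℝ) ε0, ∀ x ∈ Icc (0:ℝ) L,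
      y ε x = a * u ε x + b * v ε x
        + ∫ s in x..L, (u ε x * v ε s - v ε x * u ε s) * T s * y ε s) :
    Tendsto (fun ε : ℝ => ⨆ x : Icc (0:ℝ) L,
        |y ε x.1 - a * u ε x.1 - b * v ε x.1|)
      (𝓝[>] 0) (𝓝 0) := by
  have hmc : ContinuousOn m (Icc 0 L) := fun x hx => (hm x hx).continuousAt.continuousWithinAt
  have hm'c : ContinuousOn m' (Icc 0 L) := fun x hx => (hm' x hx).continuousAt.continuousWithinAt
  have hTc := continuousOn_potential hL.le hmc hm'c hm''c hmpos hT
  obtain ⟨B, hB, hBle⟩ := exists_amplitude_le hL hM hmc hmpos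
  set C : ℝ := K1 + 2 * B ^ 2 * T0 * L with hC
  have hCpos : 0 < C := by positivity
  have hbound : ∀ ε ∈ Ioo (0 : ℝ) ε0, C * ε ≤ 1 / 2 → ∀ x ∈ Icc (0 : ℝ) L,
      |y ε x - a * u ε x - b * v ε x| ≤ C * ε * (2 * ((|a| + |b|) * (B * √ε))) := by
    intro ε hε hCε
    have hε' : 0 < ε := hε.1
    have hub' : ∀ s ∈ Icc (0 : ℝ) L, |u ε s| ≤ B * √ε := fun s hs =>
      (hub ε hε s hs).trans (hBle ε hε' s hs)
    have hvb' : ∀ s ∈ Icc (0 : ℝ) L, |v ε s| ≤ B * √ε := fun s hs =>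
      (hvb ε hε s hs).trans (hBle ε hε' s hs)
    obtain ⟨z, hz, hmax⟩ := isCompact_Icc.exists_isMaxOn (nonempty_Icc.2 hL.le) (hyc ε hε).abs
    have hres : ∀ x ∈ Icc (0 : ℝ) L,
        |y ε x - a * u ε x - b * v ε x| ≤ C * ε * |y ε z| := by
      rw [← closure_Ioc hL.ne]
      refine fun x hx => ContinuousWithinAt.closure_le
        (f := fun x => |y ε x - a * u ε x - b * v ε x|) hx ?_ continuousWithinAt_const ?_
      · rw [closure_Ioc hL.ne] at hx
        exact ((((hyc ε hε).sub (continuousOn_const.mul (huc ε hε))).sub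
          (continuousOn_const.mul (hvc ε hε))).abs x hx).mono Ioc_subset_Icc_self
      · intro s hs
        have h := abs_volterra_integral_le hρ (by positivity) hTc hT0.le hTb (huc ε hε) (hvc ε hε)
          hub' hvb' (hnear ε hε) (fun s hs => hmax hs) hs
        have hCeq : K1 * ε + 2 * (B * √ε) ^ 2 * T0 * L = C * ε := by
          rw [mul_pow, Real.sq_sqrt hε'.le, hC]
          ring
        rw [hCeq] at h
        refine (congrArg abs ?_).trans_le h
        linarith [hyeq ε hε s (Ioc_subset_Icc_self hs)]
    have hY : |y ε z| ≤ 2 * ((|a| + |b|) * (B * √ε)) := by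
      have h1 := hres z hz
      have h2 : C * ε * |y ε z| ≤ 1 / 2 * |y ε z| :=
        mul_le_mul_of_nonneg_right hCε (abs_nonneg _)
      have h3 : |y ε z| ≤ |y ε z - a * u ε z - b * v ε z| + |a * u ε z| + |b * v ε z| := by
        calc |y ε z| = |(y ε z - a * u ε z - b * v ε z) + a * u ε z + b * v ε z| := by ring_nf
          _ ≤ _ := abs_add_three _ _ _
      rw [abs_mul, abs_mul] at h3
      have h4 := mul_le_mul_of_nonneg_left (hub' z hz) (abs_nonneg a)
      have h5 := mul_le_mul_of_nonneg_left (hvb' z hz) (abs_nonneg b)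
      linarith
    exact fun x hx => (hres x hx).trans (mul_le_mul_of_nonneg_left hY (by positivity))
  have hlim : Tendsto (fun ε : ℝ => C * ε * (2 * ((|a| + |b|) * (B * √ε)))) (𝓝[>] 0) (𝓝 0) := by
    have hcont : Continuous fun ε : ℝ => C * ε * (2 * ((|a| + |b|) * (B * √ε))) := by fun_prop
    simpa using (hcont.tendsto 0).mono_left nhdsWithin_le_nhds
  have hsmall : ∀ᶠ ε : ℝ in 𝓝[>] 0, C * ε ≤ 1 / 2 := by
    have hcont : Tendsto (fun ε : ℝ => C * ε) (𝓝[>] 0) (𝓝 (C * 0)) :=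
      ((continuous_const.mul continuous_id).tendsto 0).mono_left nhdsWithin_le_nhds
    rw [mul_zero] at hcont
    exact hcont.eventually (ge_mem_nhds (by norm_num))
  have : Nonempty (Icc (0 : ℝ) L) := ⟨⟨0, le_rfl, hL.le⟩⟩
  refine squeeze_zero' (Eventually.of_forall fun ε => Real.iSup_nonneg fun x => abs_nonneg _)
    ?_ hlim
  filter_upwards [hsmall, Ioo_mem_nhdsGT hε0] with ε hCε hε
  exact ciSup_le fun x => hbound ε hε hCε x.1 x.2
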